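/- Let n be a positive integer and let E : EuclideanSpace ℝ (Fin n) → ℝ be continuous and strictly convex (StrictConvexOn ℝ over the whole space). Suppose there is a point x̂ with E x̂ ≤ E x for all x. Then E is coercive: E x tends to +∞ as ‖x‖ → +∞ (i.e., Tendsto E (Filter.cocompact) Filter.atTop). -/

import Mathlib

/-- A continuous strictly convex function on `ℝⁿ` attaining a global minimum is
coercive. -/
theorem stmt_7 (n : ℕ) (hn : 0 < n) (E : EuclideanSpace ℝ (Fin n) → ℝ)
    (hcont : Continuous E) (hconv : StrictConvexOn ℝ Set.univ E)
    (xhat : EuclideanSpace ℝ (Fin n)) (hmin : ∀ x, E xhat ≤ E x) :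
    Filter.Tendsto E (Filter.cocompact (EuclideanSpace ℝ (Fin n))) Filter.atTop := by
  haveI : Nonempty (Fin n) := ⟨⟨0, hn⟩⟩
  have hne : (Metric.sphere xhat 1).Nonempty := NormedSpace.sphere_nonempty.2 zero_le_one
  obtain ⟨y, hy, hymin⟩ := (isCompact_sphere xhat 1).exists_isMinOn hne hcont.continuousOn
  have hyx : y ≠ xhat := by
    rintro rfl
    simp at hy
  have hc : 0 < E y - E xhat := by
    have h := hconv.2 (Set.mem_univ y) (Set.mem_univ xhat) hyx
      (show (0 : ℝ) < 1 / 2 by norm_num) (show (0 : ℝ) < 1 / 2 by norm_num) (by norm_num)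
    have h2 := hmin ((1 / 2 : ℝ) • y + (1 / 2 : ℝ) • xhat)
    simp only [smul_eq_mul] at h
    linarith
  have hd : Filter.Tendsto (fun x => dist x xhat)
      (Filter.cocompact (EuclideanSpace ℝ (Fin n))) Filter.atTop :=
    tendsto_dist_right_cocompact_atTop xhat
  refine Filter.tendsto_atTop_mono' _ ?_
    (Filter.tendsto_atTop_add_const_left _ (E xhat) (hd.atTop_mul_const hc))
  filter_upwards [hd.eventually_ge_atTop 1] with x hx
  set r := dist x xhat with hr
  have hr0 : 0 < r := by linarith
  have hi : r⁻¹ ≤ 1 := inv_le_one_of_one_le₀ hx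
  have hmem : (1 - r⁻¹) • xhat + r⁻¹ • x ∈ Metric.sphere xhat 1 := by
    have : (1 - r⁻¹) • xhat + r⁻¹ • x - xhat = r⁻¹ • (x - xhat) := by module
    rw [mem_sphere_iff_norm, this, norm_smul, ← dist_eq_norm, ← hr, Real.norm_eq_abs,
      abs_of_pos (inv_pos.2 hr0), inv_mul_cancel₀ hr0.ne']
  have h1 : E y ≤ E ((1 - r⁻¹) • xhat + r⁻¹ • x) := hymin hmem
  have h2 := hconv.convexOn.2 (Set.mem_univ xhat) (Set.mem_univ x)
    (sub_nonneg.2 hi) (inv_pos.2 hr0).le (by ring)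
  simp only [smul_eq_mul] at h2
  have h3 : E y - E xhat ≤ r⁻¹ * (E x - E xhat) := by linarith
  have h4 := mul_le_mul_of_nonneg_left h3 hr0.le
  rw [mul_inv_cancel_left₀ hr0.ne'] at h4
  linarith
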